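/- Let C be a 10-element subset of the unit sphere S³ ⊆ ℝ⁴ such that any two distinct points of C have inner product at most 1/6. Then for all distinct c, c' ∈ C, the inner product ⟨c, c'⟩ equals either −2/3 or 1/6. -/

import Mathlib

open scoped RealInnerProductSpace

namespace Petersen

variable {α : Type*} [DecidableEq α]

/-- Sum over ordered triples of distinct elements. -/
def D (S : Finset α) (f : α → α → α → ℝ) : ℝ :=
  ∑ i ∈ S, ∑ j ∈ S.erase i, ∑ k ∈ (S.erase i).erase j, f i j k

lemma D_swap12 (S : Finset α) (f : α → α → α → ℝ) : D S f = D S (fun i j k => f j i k) := by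
  unfold D
  rw [Finset.sum_comm' (t' := S) (s' := fun j => S.erase j)
    (by intro x y; simp only [Finset.mem_erase]; tauto)]
  refine Finset.sum_congr rfl fun i _ => Finset.sum_congr rfl fun j _ => ?_
  rw [Finset.erase_right_comm]

lemma D_swap23 (S : Finset α) (f : α → α → α → ℝ) : D S f = D S (fun i j k => f i k j) := by
  unfold D
  refine Finset.sum_congr rfl fun i _ => ?_
  exact Finset.sum_comm' (by intro x y; simp only [Finset.mem_erase]; tauto)

lemma D_add (S : Finset α) (f g : α → α → α → ℝ) :
    D S (fun i j k => f i j k + g i j k) = D S f + D S g := by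
  simp only [D, Finset.sum_add_distrib]

/-- Splitting the full triple sum according to coincidences. -/
lemma sum_split (S : Finset α) (hS : S.card = 10) (f : α → α → α → ℝ) :
    ∑ i ∈ S, ∑ j ∈ S, ∑ k ∈ S, f i j k =
      D S (fun i j k => f i j k + (f i i j + f i j i + f i j j) / 8 + f i i i / 72) := by
  unfold D
  refine Finset.sum_congr rfl fun i hi => ?_
  have hE : (S.erase i).card = 9 := by rw [Finset.card_erase_of_mem hi, hS]
  have h1 : ∀ j ∈ S.erase i, ∑ k ∈ (S.erase i).erase j,
      (f i j k + (f i i j + f i j i + f i j j) / 8 + f i i i / 72) =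
      (∑ k ∈ S, f i j k) + f i i j + f i i i / 9 := by
    intro j hj
    have hE2 : ((S.erase i).erase j).card = 8 := by rw [Finset.card_erase_of_mem hj, hE]
    rw [Finset.sum_add_distrib, Finset.sum_add_distrib, Finset.sum_const, Finset.sum_const, hE2,
      ← Finset.add_sum_erase S _ hi, ← Finset.add_sum_erase (S.erase i) _ hj]
    simp only [nsmul_eq_mul]
    push_cast
    ring
  rw [Finset.sum_congr rfl h1, Finset.sum_add_distrib, Finset.sum_add_distrib, Finset.sum_const, hE,
    ← Finset.add_sum_erase S _ hi, ← Finset.add_sum_erase S (fun k => f i i k) hi]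
  simp only [nsmul_eq_mul]
  push_cast
  ring

/-- The three-point kernel, in the variables `a = (1 - 6 u) / 5`. -/
noncomputable def K (a b t : ℝ) : ℝ :=
  42 / 25 * (((1 - 5 * a) - 75 / 14 * (a ^ 3 - a)) * ((1 - 5 * b) - 75 / 14 * (b ^ 3 - b)))
  + 25 / 14 * ((a ^ 3 - a) * (b ^ 3 - b))
  + 72 / 25 * ((1 + 5 / 3 * a ^ 2) * (1 + 5 / 3 * b ^ 2)
      * ((1 - 5 * t) / 6 - (1 - 5 * a) / 6 * ((1 - 5 * b) / 6)))
  + 88 * (a ^ 2 * b ^ 2 * ((1 - 5 * t) / 6 - (1 - 5 * a) / 6 * ((1 - 5 * b) / 6)))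
  + 216 / 25 * (4 * ((1 - 5 * t) / 6) ^ 2 - 1)

/-- The contribution of a triple of distinct points. -/
noncomputable def G (a b t : ℝ) : ℝ :=
  K a b t + (K (-1) a a + K a (-1) a + K a a (-1)) / 8 + K (-1) (-1) (-1) / 72

/-- The nonnegative polynomial certifying that `G` is nonpositive on average. -/
noncomputable def T (a b c : ℝ) : ℝ :=
  (4 * (c ^ 2 - c) ^ 2 + 25 / 12 * (c ^ 3 - c ^ 2) ^ 2 + 8 * (a * b * c) ^ 2
    - 31 / 6 * (c ^ 2 - c) * (c ^ 3 - c ^ 2) + 4 * (c ^ 2 - c) * (a * b * c)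
    - 4 * (c ^ 3 - c ^ 2) * (a * b * c))
  + a * (45 / 4 * (a - 1) ^ 2 + 6 * (a ^ 2 - a) ^ 2 + 40 * (a * c - c) ^ 2 + 68 * (b * c) ^ 2
    - 14 * (a - 1) * (a ^ 2 - a) - 50 / 3 * (a - 1) * (a * c - c)
    - 8 * (a ^ 2 - a) * (b * c) - 4 * (a * c - c) * (b * c))
  + a * b * (4 * (c ^ 2) ^ 2 - 8 * c ^ 2 * ((a - 1) * (b - 1)) + 50 / 3 * ((a - 1) * (b - 1)) ^ 2)

lemma GT_identity (a b t : ℝ) :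
    (G a b t + G b a t + G a t b + G b t a + G t a b + G t b a)
    + (T a b t + T b a t + T a t b + T b t a + T t a b + T t b a) = 0 := by
  unfold G K T
  ring

lemma q1 (x y z : ℝ) : 0 ≤ 4 * x ^ 2 + 25 / 12 * y ^ 2 + 8 * z ^ 2
    - 31 / 6 * x * y + 4 * x * z - 4 * y * z := by
  nlinarith [sq_nonneg (x - 31 / 48 * y + z / 2), sq_nonneg (y - 408 / 239 * z), sq_nonneg z]

lemma q2 (x y z w : ℝ) : x ^ 2 / 4 ≤ 45 / 4 * x ^ 2 + 6 * y ^ 2 + 40 * z ^ 2 + 68 * w ^ 2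
    - 14 * x * y - 50 / 3 * x * z - 8 * y * w - 4 * z * w := by
  have h : 45 / 4 * x ^ 2 + 6 * y ^ 2 + 40 * z ^ 2 + 68 * w ^ 2
      - 14 * x * y - 50 / 3 * x * z - 8 * y * w - 4 * z * w - x ^ 2 / 4 =
      11 * (x - 7 / 11 * y - 25 / 33 * z) ^ 2 + 17 / 11 * (y - 175 / 51 * z - 44 / 17 * w) ^ 2
      + 790 / 51 * (z - 401 / 395 * w) ^ 2 + 49394 / 1185 * w ^ 2 := by
    ring
  have h' : 0 ≤ 11 * (x - 7 / 11 * y - 25 / 33 * z) ^ 2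
      + 17 / 11 * (y - 175 / 51 * z - 44 / 17 * w) ^ 2
      + 790 / 51 * (z - 401 / 395 * w) ^ 2 + 49394 / 1185 * w ^ 2 := by
    positivity
  linarith

lemma q3 (x y : ℝ) : 0 ≤ 4 * x ^ 2 - 8 * x * y + 50 / 3 * y ^ 2 := by
  nlinarith [sq_nonneg (x - y), sq_nonneg y]

lemma T_lower (a b c : ℝ) (ha : 0 ≤ a) (hb : 0 ≤ b) : a * ((a - 1) ^ 2 / 4) ≤ T a b c := by
  have h1 := q1 (c ^ 2 - c) (c ^ 3 - c ^ 2) (a * b * c)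
  have h2 := mul_le_mul_of_nonneg_left (q2 (a - 1) (a ^ 2 - a) (a * c - c) (b * c)) ha
  have h3 := mul_nonneg (mul_nonneg ha hb) (q3 (c ^ 2) ((a - 1) * (b - 1)))
  unfold T
  linarith

section geometry

variable {E : Type*} [NormedAddCommGroup E] [InnerProductSpace ℝ E]

lemma k0 {F : Type*} (S : Finset F) (w : F → ℝ) : 0 ≤ ∑ x ∈ S, ∑ y ∈ S, w x * w y := by
  rw [← Finset.sum_mul_sum]
  exact mul_self_nonneg _

lemma k1 (S : Finset E) (w : E → ℝ) (c : E) (hc : ‖c‖ = 1) :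
    0 ≤ ∑ x ∈ S, ∑ y ∈ S, w x * w y * (⟪x, y⟫ - ⟪c, x⟫ * ⟪c, y⟫) := by
  have h : ∑ x ∈ S, ∑ y ∈ S, w x * w y * (⟪x, y⟫ - ⟪c, x⟫ * ⟪c, y⟫) =
      ⟪∑ x ∈ S, w x • x, ∑ x ∈ S, w x • x⟫ - ⟪c, ∑ x ∈ S, w x • x⟫ * ⟪c, ∑ x ∈ S, w x • x⟫ := by
    rw [sum_inner, inner_sum, Finset.sum_mul_sum, ← Finset.sum_sub_distrib]
    refine Finset.sum_congr rfl fun x _ => ?_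
    rw [inner_sum, ← Finset.sum_sub_distrib]
    refine Finset.sum_congr rfl fun y _ => ?_
    simp only [real_inner_smul_left, real_inner_smul_right]
    ring
  rw [h]
  have h2 := real_inner_mul_inner_self_le c (∑ x ∈ S, w x • x)
  rw [real_inner_self_eq_norm_sq c, hc] at h2
  linarith

lemma k2 (S : Finset (EuclideanSpace ℝ (Fin 4))) (hS : ∀ x ∈ S, ‖x‖ = 1) :
    0 ≤ ∑ x ∈ S, ∑ y ∈ S, (4 * ⟪x, y⟫ ^ 2 - 1) := by
  have hin : ∀ x y : EuclideanSpace ℝ (Fin 4), ⟪x, y⟫ = ∑ i, x i * y i := by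
    intro x y
    simp [PiLp.inner_apply, mul_comm]
  set M : Fin 4 → Fin 4 → ℝ := fun i j => ∑ x ∈ S, x i * x j with hM
  have h1 : ∑ x ∈ S, ∑ y ∈ S, ⟪x, y⟫ ^ 2 = ∑ i, ∑ j, M i j ^ 2 := by
    have e : ∀ i j, M i j ^ 2 = ∑ x ∈ S, ∑ y ∈ S, (x i * y i) * (x j * y j) := by
      intro i j
      rw [sq, hM, Finset.sum_mul_sum]
      exact Finset.sum_congr rfl fun x _ => Finset.sum_congr rfl fun y _ => by ring
    simp only [e, hin, sq, Finset.sum_mul_sum]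
    simp only [Finset.sum_comm (s := (Finset.univ : Finset (Fin 4))) (t := S)]
  have h2 : ∑ i, M i i = S.card := by
    simp only [hM]
    rw [Finset.sum_comm]
    have : ∀ x ∈ S, ∑ i, x i * x i = 1 := by
      intro x hx
      rw [← hin, real_inner_self_eq_norm_sq, hS x hx]; norm_num
    rw [Finset.sum_congr rfl this]; simp
  have h3 : ∑ i, M i i ^ 2 ≤ ∑ i, ∑ j, M i j ^ 2 :=
    Finset.sum_le_sum fun i _ =>
      Finset.single_le_sum (f := fun j => M i j ^ 2) (fun j _ => sq_nonneg _) (Finset.mem_univ i)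
  have h4 : (∑ i, M i i) ^ 2 ≤ 4 * ∑ i, M i i ^ 2 := by
    have := sq_sum_le_card_mul_sum_sq (s := (Finset.univ : Finset (Fin 4))) (f := fun i => M i i)
    simpa using this
  have h5 : ∑ x ∈ S, ∑ y ∈ S, (4 * ⟪x, y⟫ ^ 2 - 1) =
      4 * (∑ x ∈ S, ∑ y ∈ S, ⟪x, y⟫ ^ 2) - (S.card : ℝ) ^ 2 := by
    simp only [Finset.sum_sub_distrib, ← Finset.mul_sum]
    simp [sq]
  rw [h5, h1]
  rw [h2] at h4
  linarith

end geometry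

/-- The rescaled inner product. -/
noncomputable def A (x y : EuclideanSpace ℝ (Fin 4)) : ℝ := (1 - 6 * ⟪x, y⟫) / 5

lemma A_comm (x y : EuclideanSpace ℝ (Fin 4)) : A x y = A y x := by
  unfold A; rw [real_inner_comm]

lemma A_inner (x y : EuclideanSpace ℝ (Fin 4)) : (1 - 5 * A x y) / 6 = ⟪x, y⟫ := by
  unfold A; ring

lemma A_self (x : EuclideanSpace ℝ (Fin 4)) (hx : ‖x‖ = 1) : A x x = -1 := by
  unfold A; rw [real_inner_self_eq_norm_sq, hx]; norm_num

lemma K_sum (S : Finset (EuclideanSpace ℝ (Fin 4))) (hS : ∀ x ∈ S, ‖x‖ = 1) :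
    0 ≤ ∑ c ∈ S, ∑ x ∈ S, ∑ y ∈ S, K (A c x) (A c y) (A x y) := by
  refine Finset.sum_nonneg fun c hc => ?_
  simp only [K, Finset.sum_add_distrib, ← Finset.mul_sum, A_inner]
  have h1 := k0 S (fun x => (1 - 5 * A c x) - 75 / 14 * ((A c x) ^ 3 - A c x))
  have h2 := k0 S (fun x => (A c x) ^ 3 - A c x)
  have h3 := k1 S (fun x => 1 + 5 / 3 * (A c x) ^ 2) c (hS c hc)
  have h4 := k1 S (fun x => (A c x) ^ 2) c (hS c hc)
  have h5 := k2 S hS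
  refine add_nonneg (add_nonneg (add_nonneg (add_nonneg ?_ ?_) ?_) ?_) ?_
  · exact mul_nonneg (by norm_num) (by simpa only [← Finset.mul_sum] using h1)
  · exact mul_nonneg (by norm_num) (by simpa only [← Finset.mul_sum] using h2)
  · exact mul_nonneg (by norm_num) h3
  · exact mul_nonneg (by norm_num) h4
  · exact mul_nonneg (by norm_num) h5

end Petersen

open Petersen in
theorem petersen_two_distance_set
    (C : Finset (EuclideanSpace ℝ (Fin 4)))
    (hcard : C.card = 10)
    (hunit : ∀ c ∈ C, ‖c‖ = 1)
    (hinner : ∀ c ∈ C, ∀ c' ∈ C, c ≠ c' → ⟪c, c'⟫ ≤ (1 / 6 : ℝ)) :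
    ∀ c ∈ C, ∀ c' ∈ C, c ≠ c' → ⟪c, c'⟫ = (-2 / 3 : ℝ) ∨ ⟪c, c'⟫ = (1 / 6 : ℝ) := by
  classical
  have hA : ∀ c ∈ C, ∀ c' ∈ C, c ≠ c' → 0 ≤ A c c' := by
    intro c hc c' hc' h
    have := hinner c hc c' hc' h
    unfold A; linarith
  -- total
  have h0 := K_sum C hunit
  rw [sum_split C hcard] at h0
  have hG : D C (fun i j k => K (A i j) (A i k) (A j k) +
      (K (A i i) (A i j) (A i j) + K (A i j) (A i i) (A j i) + K (A i j) (A i j) (A j j)) / 8 +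
      K (A i i) (A i i) (A i i) / 72) = D C (fun i j k => G (A i j) (A i k) (A j k)) := by
    unfold D
    refine Finset.sum_congr rfl fun i hi => Finset.sum_congr rfl fun j hj =>
      Finset.sum_congr rfl fun k hk => ?_
    beta_reduce
    rw [A_self i (hunit i hi), A_self j (hunit j (Finset.mem_of_mem_erase hj)), A_comm j i]
    rfl
  rw [hG] at h0
  -- symmetrization
  have hsym : ∀ f : ℝ → ℝ → ℝ → ℝ,
      D C (fun i j k => f (A i j) (A i k) (A j k) + f (A i k) (A i j) (A j k)
        + f (A i j) (A j k) (A i k) + f (A i k) (A j k) (A i j)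
        + f (A j k) (A i j) (A i k) + f (A j k) (A i k) (A i j))
      = 6 * D C (fun i j k => f (A i j) (A i k) (A j k)) := by
    intro f
    have e1 : D C (fun i j k => f (A i k) (A i j) (A j k)) =
        D C (fun i j k => f (A i j) (A i k) (A j k)) := by
      rw [D_swap23]; simp only [A_comm]
    have e2 : D C (fun i j k => f (A i j) (A j k) (A i k)) =
        D C (fun i j k => f (A i j) (A i k) (A j k)) := by
      rw [D_swap12]; simp only [A_comm]
    have e3 : D C (fun i j k => f (A i k) (A j k) (A i j)) =
        D C (fun i j k => f (A i j) (A i k) (A j k)) := by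
      rw [D_swap23, ← e2]; simp only [A_comm]
    have e4 : D C (fun i j k => f (A j k) (A i j) (A i k)) =
        D C (fun i j k => f (A i j) (A i k) (A j k)) := by
      rw [← e1, D_swap12]; simp only [A_comm]
    have e5 : D C (fun i j k => f (A j k) (A i k) (A i j)) =
        D C (fun i j k => f (A i j) (A i k) (A j k)) := by
      rw [← e4, D_swap23]; simp only [A_comm]
    simp only [D_add]
    linarith
  have hsum : D C (fun i j k => G (A i j) (A i k) (A j k))
      + D C (fun i j k => T (A i j) (A i k) (A j k)) = 0 := by
    have h6 : 6 * D C (fun i j k => G (A i j) (A i k) (A j k))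
      + 6 * D C (fun i j k => T (A i j) (A i k) (A j k)) = 0 := by
      rw [← hsym G, ← hsym T, ← D_add]
      simp only [GT_identity]
      simp [D]
    linarith
  have hT : D C (fun i j k => T (A i j) (A i k) (A j k)) ≤ 0 := by linarith
  have hlow : ∀ i ∈ C, ∀ j ∈ C.erase i, ∀ k ∈ (C.erase i).erase j,
      A i j * ((A i j - 1) ^ 2 / 4) ≤ T (A i j) (A i k) (A j k) := by
    intro i hi j hj k hk
    simp only [Finset.mem_erase] at hj hk
    exact T_lower _ _ _ (hA i hi j hj.2 (Ne.symm hj.1)) (hA i hi k hk.2.2 (Ne.symm hk.2.1))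
  have hnn : ∀ i ∈ C, ∀ j ∈ C.erase i, 0 ≤ A i j * ((A i j - 1) ^ 2 / 4) := by
    intro i hi j hj
    simp only [Finset.mem_erase] at hj
    exact mul_nonneg (hA i hi j hj.2 (Ne.symm hj.1)) (by positivity)
  intro c hc c' hc' hne
  have hc'E : c' ∈ C.erase c := Finset.mem_erase.2 ⟨Ne.symm hne, hc'⟩
  have hk : ((C.erase c).erase c').Nonempty := by
    rw [← Finset.card_pos, Finset.card_erase_of_mem hc'E, Finset.card_erase_of_mem hc, hcard]
    norm_num
  obtain ⟨k, hk⟩ := hk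
  have hT0 : ∀ i ∈ C, ∀ j ∈ C.erase i, ∀ k ∈ (C.erase i).erase j,
      0 ≤ T (A i j) (A i k) (A j k) := fun i hi j hj k hk =>
    (hnn i hi j hj).trans (hlow i hi j hj k hk)
  have s1 : T (A c c') (A c k) (A c' k) ≤ D C (fun i j k => T (A i j) (A i k) (A j k)) := by
    unfold D
    calc T (A c c') (A c k) (A c' k)
        ≤ ∑ k ∈ (C.erase c).erase c', T (A c c') (A c k) (A c' k) :=
          Finset.single_le_sum (f := fun k => T (A c c') (A c k) (A c' k))
            (hT0 c hc c' hc'E) hk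
      _ ≤ ∑ j ∈ C.erase c, ∑ k ∈ (C.erase c).erase j, T (A c j) (A c k) (A j k) :=
          Finset.single_le_sum
            (f := fun j => ∑ k ∈ (C.erase c).erase j, T (A c j) (A c k) (A j k))
            (fun j hj => Finset.sum_nonneg (hT0 c hc j hj)) hc'E
      _ ≤ _ :=
          Finset.single_le_sum
            (f := fun i => ∑ j ∈ C.erase i, ∑ k ∈ (C.erase i).erase j, T (A i j) (A i k) (A j k))
            (fun i hi => Finset.sum_nonneg fun j hj => Finset.sum_nonneg (hT0 i hi j hj)) hc
  have hz : A c c' * ((A c c' - 1) ^ 2 / 4) = 0 :=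
    le_antisymm ((hlow c hc c' hc'E k hk).trans (s1.trans hT)) (hnn c hc c' hc'E)
  rcases mul_eq_zero.1 hz with h | h
  · right
    rw [← A_inner, h]; norm_num
  · left
    have h' : A c c' - 1 = 0 := by
      have : (A c c' - 1) ^ 2 = 0 := by linarith
      exact pow_eq_zero_iff (two_ne_zero) |>.1 this
    have h'' : A c c' = 1 := by linarith
    rw [← A_inner, h'']; norm_num
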